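/- For every real s > −1, the sequence of partial sums ∑_{k=3}^{n} (−1)^k · 2 k^{−s} tan(π/k) · exp(2πi(1/k − 2H_k)) converges to a limit in ℂ as n → ∞. -/

import Mathlib

open Real Filter Topology

/-- The `k`-th harmonic number `H_k = ∑_{m=1}^{k} 1/m`. -/
noncomputable def H (k : ℕ) : ℝ := ∑ m ∈ Finset.Icc 1 k, (1 : ℝ) / m

/-- An alternating series converges when its terms tend to zero and have bounded variation. -/
theorem exists_tendsto_alternating_sum {b : ℕ → ℂ} (hb : Tendsto b atTop (𝓝 0))
    (hv : Summable fun k => ‖b k - b (k + 1)‖) :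
    ∃ L : ℂ, Tendsto (fun n => ∑ k ∈ Finset.range n, (-1 : ℂ) ^ k * b k) atTop (𝓝 L) := by
  have parts : ∀ n, ∑ k ∈ Finset.range n, (-1 : ℂ) ^ k * b k =
      (∑ k ∈ Finset.range n, (-1 : ℂ) ^ k * (b k - b (k + 1)) + b 0 - (-1) ^ n * b n) / 2 := by
    intro n
    induction n with
    | zero => simp
    | succ n ih =>
      rw [Finset.sum_range_succ, Finset.sum_range_succ, ih]
      ring
  have hs : Summable fun k => (-1 : ℂ) ^ k * (b k - b (k + 1)) :=
    .of_norm (by simpa using hv)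
  have h0 : Tendsto (fun n => (-1 : ℂ) ^ n * b n) atTop (𝓝 0) := by
    rw [tendsto_zero_iff_norm_tendsto_zero] at hb ⊢
    simpa using hb
  refine ⟨_, Tendsto.congr (fun n => (parts n).symm)
    (((hs.hasSum.tendsto_sum_nat.add_const (b 0)).sub h0).div_const 2)⟩

theorem summable_sub_succ_of_antitone {a : ℕ → ℝ} (ha : Antitone a) (h0 : ∀ k, 0 ≤ a k) :
    Summable fun k => a k - a (k + 1) := by
  refine summable_of_sum_range_le (c := a 0) (fun k => sub_nonneg.2 (ha k.le_succ)) fun n => ?_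
  rw [Finset.sum_range_sub']
  linarith [h0 n]

theorem convexOn_tan_Ico : ConvexOn ℝ (Set.Ico 0 (π / 2)) Real.tan := by
  have hcos : ∀ x ∈ Set.Ico 0 (π / 2), 0 < Real.cos x := fun x hx =>
    Real.cos_pos_of_mem_Ioo ⟨by linarith [hx.1, Real.pi_pos], hx.2⟩
  refine MonotoneOn.convexOn_of_deriv (convex_Ico _ _)
    (fun x hx => (Real.continuousAt_tan.2 (hcos x hx).ne').continuousWithinAt) ?_ ?_
  · intro x hx
    exact (Real.differentiableAt_tan.2
      (hcos x (interior_subset hx)).ne').differentiableWithinAt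
  · intro x hx y hy hxy
    have hx' := interior_subset hx
    have hy' := interior_subset hy
    have h := hcos y hy'
    have hle : Real.cos y ≤ Real.cos x :=
      Real.cos_le_cos_of_nonneg_of_le_pi hx'.1 (by linarith [hy'.2, Real.pi_pos]) hxy
    rw [Real.deriv_tan, Real.deriv_tan]
    gcongr

theorem tan_le_div_mul_tan {x y : ℝ} (hx : 0 ≤ x) (hxy : x ≤ y) (h0 : 0 < y) (hy : y < π / 2) :
    Real.tan x ≤ x / y * Real.tan y := by
  have h : Real.tan ((1 - x / y) • 0 + (x / y) • y) ≤
      (1 - x / y) • Real.tan 0 + (x / y) • Real.tan y :=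
    convexOn_tan_Ico.2 ⟨le_rfl, by positivity⟩ ⟨h0.le, hy⟩
      (sub_nonneg.2 ((div_le_one h0).2 hxy)) (by positivity) (by ring)
  simpa [div_mul_cancel₀ x h0.ne'] using h

theorem antitone_mul_tan_pi_div : Antitone fun j : ℕ => ((j : ℝ) + 3) * Real.tan (π / (j + 3)) := by
  refine antitone_nat_of_succ_le fun j => ?_
  have hj : (0 : ℝ) ≤ j := j.cast_nonneg
  have h := tan_le_div_mul_tan (x := π / (j + 1 + 3)) (y := π / (j + 3)) (by positivity)
    (by gcongr; linarith) (by positivity) (by gcongr; linarith)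
  have e : π / ((j : ℝ) + 1 + 3) / (π / (j + 3)) = (j + 3) / (j + 1 + 3) := by
    field_simp
  rw [e] at h
  push_cast
  calc ((j : ℝ) + 1 + 3) * Real.tan (π / (j + 1 + 3))
      ≤ (j + 1 + 3) * ((j + 3) / (j + 1 + 3) * Real.tan (π / (j + 3))) := by gcongr
    _ = (j + 3) * Real.tan (π / (j + 3)) := by field_simp

theorem tan_pi_div_nonneg (j : ℕ) : 0 ≤ Real.tan (π / ((j : ℝ) + 3)) :=
  Real.tan_nonneg_of_nonneg_of_le_pi_div_two (by positivity)
    (by gcongr; linarith [j.cast_nonneg (α := ℝ)])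

/-- The side length of the regular `(j + 3)`-gon circumscribed about a circle of radius
`(j + 3) ^ (-s)`. -/
noncomputable def circLength (s : ℝ) (j : ℕ) : ℝ :=
  2 * ((j : ℝ) + 3) ^ (-s) * Real.tan (π / (j + 3))

theorem circLength_nonneg (s : ℝ) (j : ℕ) : 0 ≤ circLength s j :=
  mul_nonneg (by positivity) (tan_pi_div_nonneg j)

theorem circLength_eq (s : ℝ) (j : ℕ) : circLength s j =
    2 * ((j : ℝ) + 3) ^ (-(s + 1)) * (((j : ℝ) + 3) * Real.tan (π / (j + 3))) := by
  have h : ((j : ℝ) + 3) ^ (-s) = ((j : ℝ) + 3) ^ (-(s + 1)) * (j + 3) := by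
    rw [← Real.rpow_add_one (by positivity)]
    ring_nf
  rw [circLength, h]
  ring

theorem antitone_circLength {s : ℝ} (hs : -1 < s) : Antitone (circLength s) := by
  intro j k hjk
  have hjk' : (j : ℝ) ≤ k := by exact_mod_cast hjk
  rw [circLength_eq, circLength_eq]
  have h := antitone_mul_tan_pi_div hjk
  have hk := tan_pi_div_nonneg k
  refine mul_le_mul ?_ h (by positivity) (by positivity)
  gcongr 2 * ?_
  exact Real.rpow_le_rpow_of_nonpos (by positivity) (by linarith) (by linarith)

theorem circLength_le (s : ℝ) (j : ℕ) :
    circLength s j ≤ 6 * Real.tan (π / 3) * ((j : ℝ) + 3) ^ (-(s + 1)) := by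
  have h := antitone_mul_tan_pi_div j.zero_le
  simp only [Nat.cast_zero, zero_add] at h
  rw [circLength_eq]
  calc _ ≤ 2 * ((j : ℝ) + 3) ^ (-(s + 1)) * (3 * Real.tan (π / 3)) := by gcongr
    _ = _ := by ring

theorem tendsto_circLength {s : ℝ} (hs : -1 < s) : Tendsto (circLength s) atTop (𝓝 0) := by
  refine squeeze_zero (circLength_nonneg s) (circLength_le s) ?_
  have h := ((tendsto_rpow_neg_atTop (y := s + 1) (by linarith)).comp
    (tendsto_atTop_add_const_right _ 3 tendsto_natCast_atTop_atTop)).const_mul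
      (6 * Real.tan (π / 3))
  simpa using h

/-- The angle, in radians, of the `(j + 3)`-rd vertex direction. -/
noncomputable def circAngle (j : ℕ) : ℝ := 2 * π * (1 / ((j : ℝ) + 3) - 2 * H (j + 3))

theorem H_succ (k : ℕ) : H (k + 1) = H k + 1 / ((k : ℝ) + 1) := by
  rw [H, H, Finset.sum_Icc_succ_top (by omega)]
  push_cast
  rfl

theorem abs_circAngle_sub_succ_le (j : ℕ) :
    |circAngle j - circAngle (j + 1)| ≤ 6 * π * ((j : ℝ) + 3)⁻¹ := by
  have e : circAngle j - circAngle (j + 1) =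
      2 * π * (((j : ℝ) + 3)⁻¹ + ((j : ℝ) + 4)⁻¹) := by
    have h : H (j + 1 + 3) = H (j + 3) + 1 / ((j : ℝ) + 4) := by
      rw [show j + 1 + 3 = j + 3 + 1 by ring, H_succ]
      push_cast
      ring_nf
    rw [circAngle, circAngle, h]
    push_cast
    ring
  have h : ((j : ℝ) + 4)⁻¹ ≤ ((j : ℝ) + 3)⁻¹ := by gcongr; norm_num
  have h3 : 0 < ((j : ℝ) + 3)⁻¹ := by positivity
  rw [e, abs_of_nonneg (by positivity)]
  nlinarith [Real.pi_pos]

theorem norm_exp_ofReal_mul_I_sub_le (x y : ℝ) :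
    ‖Complex.exp (x * Complex.I) - Complex.exp (y * Complex.I)‖ ≤ |x - y| := by
  have e : Complex.exp (x * Complex.I) - Complex.exp (y * Complex.I) =
      Complex.exp (y * Complex.I) * (Complex.exp (Complex.I * ((x - y : ℝ) : ℂ)) - 1) := by
    rw [mul_sub, ← Complex.exp_add, mul_one]
    push_cast
    ring_nf
  rw [e, norm_mul, Complex.norm_exp_ofReal_mul_I, one_mul]
  exact Real.norm_exp_I_mul_ofReal_sub_one_le

theorem summable_norm_edge_sub_succ {s : ℝ} (hs : -1 < s) : Summable fun j =>
    ‖(circLength s j : ℂ) * Complex.exp (circAngle j * Complex.I) -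
      circLength s (j + 1) * Complex.exp (circAngle (j + 1) * Complex.I)‖ := by
  have hp : Summable fun j : ℕ => ((j : ℝ) + 3) ^ (-(s + 2)) := by
    have h := (summable_nat_add_iff 3).2
      (Real.summable_nat_rpow.2 (show -(s + 2) < -1 by linarith))
    simpa using h
  refine Summable.of_nonneg_of_le (fun _ => norm_nonneg _) (fun j => ?_)
    ((summable_sub_succ_of_antitone (antitone_circLength hs) (circLength_nonneg s)).add
      (hp.mul_left (6 * Real.tan (π / 3) * (6 * π))))
  have hd : ‖Complex.exp (circAngle j * Complex.I) -
      Complex.exp (circAngle (j + 1) * Complex.I)‖ ≤ 6 * π * ((j : ℝ) + 3)⁻¹ :=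
    (norm_exp_ofReal_mul_I_sub_le _ _).trans (abs_circAngle_sub_succ_le j)
  have hm := antitone_circLength hs j.le_succ
  have hpow : ((j : ℝ) + 3) ^ (-(s + 2)) = ((j : ℝ) + 3) ^ (-(s + 1)) * ((j : ℝ) + 3)⁻¹ := by
    rw [← Real.rpow_neg_one, ← Real.rpow_add (by positivity)]
    ring_nf
  calc _ = ‖((circLength s j - circLength s (j + 1) : ℝ) : ℂ) *
          Complex.exp (circAngle (j + 1) * Complex.I) + circLength s j *
          (Complex.exp (circAngle j * Complex.I) -
            Complex.exp (circAngle (j + 1) * Complex.I))‖ := by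
        push_cast
        ring_nf
    _ ≤ (circLength s j - circLength s (j + 1)) + circLength s j * (6 * π * ((j : ℝ) + 3)⁻¹) := by
        refine (norm_add_le _ _).trans ?_
        rw [norm_mul, norm_mul, Complex.norm_exp_ofReal_mul_I, Complex.norm_real,
          Complex.norm_real, Real.norm_of_nonneg (sub_nonneg.2 hm),
          Real.norm_of_nonneg (circLength_nonneg s j), mul_one]
        gcongr
        exact circLength_nonneg s j
    _ ≤ (circLength s j - circLength s (j + 1)) +
          6 * Real.tan (π / 3) * ((j : ℝ) + 3) ^ (-(s + 1)) * (6 * π * ((j : ℝ) + 3)⁻¹) := by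
        gcongr
        exact circLength_le s j
    _ = _ := by
        rw [hpow]
        ring

theorem circumscribed_vertex_points_converge (s : ℝ) (hs : -1 < s) :
    ∃ L : ℂ, Tendsto
      (fun n : ℕ => ∑ k ∈ Finset.Icc 3 n,
        (-1 : ℂ) ^ k * ((2 * (k : ℝ) ^ (-s) * Real.tan (π / (k : ℝ)) : ℝ) : ℂ) *
          Complex.exp (2 * (π : ℂ) * Complex.I * (1 / (k : ℂ) - 2 * (H k : ℂ))))
      atTop (𝓝 L) := by
  have h0 : Tendsto (fun j => (circLength s j : ℂ) * Complex.exp (circAngle j * Complex.I))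
      atTop (𝓝 0) := by
    rw [tendsto_zero_iff_norm_tendsto_zero]
    simpa [Complex.norm_exp_ofReal_mul_I] using (tendsto_circLength hs).abs
  obtain ⟨L, hL⟩ := exists_tendsto_alternating_sum h0 (summable_norm_edge_sub_succ hs)
  refine ⟨-L, (tendsto_add_atTop_iff_nat 2).1 (hL.neg.congr fun n => ?_)⟩
  rw [← Finset.Ico_add_one_right_eq_Icc, Finset.sum_Ico_eq_sum_range,
    show n + 2 + 1 - 3 = n by omega, ← Finset.sum_neg_distrib]
  refine Finset.sum_congr rfl fun j _ => ?_
  rw [circLength, circAngle, add_comm 3 j, pow_add]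
  push_cast
  ring_nf
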